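/- Let P', P'' ⊆ ℤ² be finite nonempty sets. Then there exist integers a₀, b₀, k_x, k_y, a finite set S of unit triangles, and integers k_T for each T ∈ S, such that for all (x,y) ∈ ℝ²: max⟨P'⟩(x,y) − max⟨P''⟩(x,y) = a₀·x + b₀·y + k_x·max(0,x) + k_y·max(0,y) + Σ_{T ∈ S} k_T · max⟨V(T)⟩(x,y), where V(T) denotes the three vertices of the triangle T. (The integers k_x, k_y, k_T may be negative, and no assumption is made that the Minkowski difference conv(P') − conv(P'') exists.) -/

import Mathlib

/-- The embedding of `ℤ²` into `ℝ²`. -/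
noncomputable def toR (p : ℤ × ℤ) : ℝ × ℝ := ((p.1 : ℝ), (p.2 : ℝ))

/-- The max-plus function `max⟨P⟩ (x,y) = max_{(a,b) ∈ P} (a·x + b·y)` associated with a
set of points `P ⊆ ℝ²`. -/
noncomputable def maxF (P : Set (ℝ × ℝ)) (x y : ℝ) : ℝ :=
  sSup ((fun a : ℝ × ℝ => a.1 * x + a.2 * y) '' P)

/-- A unit triangle: a minimum integral triangle (area 1/2, i.e. `|det| = 1`) with all
vertex coordinates nonnegative, at least one vertex on the `y`-axis and at least one
vertex on the `x`-axis. -/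
def IsUnitTriangle (T : Set (ℝ × ℝ)) : Prop :=
  ∃ p₁ p₂ p₃ : ℤ × ℤ,
    T = convexHull ℝ ({toR p₁, toR p₂, toR p₃} : Set (ℝ × ℝ)) ∧
    |(p₂.1 - p₁.1) * (p₃.2 - p₁.2) - (p₂.2 - p₁.2) * (p₃.1 - p₁.1)| = 1 ∧
    0 ≤ p₁.1 ∧ 0 ≤ p₁.2 ∧ 0 ≤ p₂.1 ∧ 0 ≤ p₂.2 ∧ 0 ≤ p₃.1 ∧ 0 ≤ p₃.2 ∧
    (p₁.1 = 0 ∨ p₂.1 = 0 ∨ p₃.1 = 0) ∧ (p₁.2 = 0 ∨ p₂.2 = 0 ∨ p₃.2 = 0)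

/-- The linear form `(x, y) ↦ a x + b y` attached to the lattice point `(a, b)`. -/
def latticeForm (p : ℤ × ℤ) (z : ℝ × ℝ) : ℝ := p.1 * z.1 + p.2 * z.2

lemma latticeForm_zero : latticeForm 0 = 0 := by
  ext z; simp [latticeForm]

lemma latticeForm_add (p q : ℤ × ℤ) : latticeForm (p + q) = latticeForm p + latticeForm q := by
  ext z; simp [latticeForm]; ring

lemma latticeForm_sub (p q : ℤ × ℤ) : latticeForm (p - q) = latticeForm p - latticeForm q := by
  ext z; simp [latticeForm]; ring

lemma latticeForm_nsmul (n : ℕ) (p : ℤ × ℤ) : latticeForm (n • p) = n • latticeForm p := by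
  ext z; simp [latticeForm]; ring

lemma latticeForm_neg (p : ℤ × ℤ) : latticeForm (-p) = -latticeForm p := by
  ext z; simp [latticeForm]; ring

/-- The functions that factor through linear terms, `max(0,x)`, `max(0,y)` and the max-plus
functions of unit triangles. -/
def factorable : AddSubgroup (ℝ × ℝ → ℝ) where
  carrier := {f | ∃ (a b kx ky : ℤ) (k : Set (ℝ × ℝ) →₀ ℤ), (∀ T ∈ k.support, IsUnitTriangle T) ∧
    ∀ z : ℝ × ℝ, f z = a * z.1 + b * z.2 + kx * max 0 z.1 + ky * max 0 z.2 +
      k.sum fun T c => (c : ℝ) * maxF (Set.extremePoints ℝ T) z.1 z.2}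
  zero_mem' := ⟨0, 0, 0, 0, 0, by simp, by simp⟩
  add_mem' := by
    classical
    rintro f g ⟨a, b, kx, ky, k, hk, hf⟩ ⟨a', b', kx', ky', k', hk', hg⟩
    refine ⟨a + a', b + b', kx + kx', ky + ky', k + k', fun T hT => ?_, fun z => ?_⟩
    · rcases Finset.mem_union.1 (Finsupp.support_add hT) with h | h
      exacts [hk T h, hk' T h]
    · rw [Finsupp.sum_add_index' (by simp) (by intros; push_cast; ring), Pi.add_apply, hf, hg]
      push_cast; ring
  neg_mem' := by
    rintro f ⟨a, b, kx, ky, k, hk, hf⟩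
    refine ⟨-a, -b, -kx, -ky, -k, fun T hT => hk T (by simpa using hT), fun z => ?_⟩
    rw [Finsupp.sum_neg_index (by simp), Pi.neg_apply, hf]
    simp only [Finsupp.sum, Int.cast_neg, neg_mul, Finset.sum_neg_distrib]
    ring

lemma latticeForm_mem (p : ℤ × ℤ) : latticeForm p ∈ factorable :=
  ⟨p.1, p.2, 0, 0, 0, by simp, by simp [latticeForm]⟩

lemma maxF_extremePoints_convexHull {V : Set (ℝ × ℝ)} (hV : V.Finite) (hne : V.Nonempty)
    (x y : ℝ) : maxF (Set.extremePoints ℝ (convexHull ℝ V)) x y = maxF V x y := by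
  have hc : IsCompact (convexHull ℝ V) := hV.isCompact_convexHull ℝ
  have hsub : Set.extremePoints ℝ (convexHull ℝ V) ⊆ V := extremePoints_convexHull_subset
  have hEne : (Set.extremePoints ℝ (convexHull ℝ V)).Nonempty :=
    hc.extremePoints_nonempty hne.convexHull
  apply le_antisymm
  · exact csSup_le_csSup (hV.image _).bddAbove (hEne.image _) (Set.image_mono hsub)
  · apply csSup_le (hne.image _)
    rintro _ ⟨v, hv, rfl⟩
    have hv' := subset_convexHull ℝ V hv
    rw [← closure_convexHull_extremePoints hc (convex_convexHull ℝ V)] at hv'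
    have hcl : IsClosed {a : ℝ × ℝ | a.1 * x + a.2 * y ≤
        maxF (Set.extremePoints ℝ (convexHull ℝ V)) x y} :=
      isClosed_le (by fun_prop) continuous_const
    have hconv : Convex ℝ {a : ℝ × ℝ | a.1 * x + a.2 * y ≤
        maxF (Set.extremePoints ℝ (convexHull ℝ V)) x y} :=
      convex_halfSpace_le ⟨fun a b => by simp; ring, fun c a => by simp; ring⟩ _
    refine closure_minimal (convexHull_min (fun a ha => ?_) hconv) hcl hv'
    exact le_csSup (((hV.subset hsub).image fun a : ℝ × ℝ => a.1 * x + a.2 * y).bddAbove)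
      ⟨a, ha, rfl⟩

lemma maxF_image_toR {P : Finset (ℤ × ℤ)} (hP : P.Nonempty) (z : ℝ × ℝ) :
    maxF (toR '' (P : Set (ℤ × ℤ))) z.1 z.2 = P.sup' hP latticeForm z := by
  rw [Finset.sup'_apply, Finset.sup'_eq_csSup_image, maxF, Set.image_image]
  rfl

/-- The max-plus function of a (possibly degenerate) lattice triangle with a vertex at the
origin. -/
def triangleForm (u v : ℤ × ℤ) : ℝ × ℝ → ℝ := 0 ⊔ latticeForm u ⊔ latticeForm v

/-- The max-plus function of a lattice segment with an endpoint at the origin. -/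
def segmentForm (u : ℤ × ℤ) : ℝ × ℝ → ℝ := 0 ⊔ latticeForm u

/-- The determinant of two lattice vectors. -/
def latticeDet (u v : ℤ × ℤ) : ℤ := u.1 * v.2 - u.2 * v.1

lemma triangleForm_comm (u v : ℤ × ℤ) : triangleForm u v = triangleForm v u := by
  unfold triangleForm; rw [sup_right_comm]

lemma latticeDet_comm (u v : ℤ × ℤ) : latticeDet u v = -latticeDet v u := by
  unfold latticeDet; ring

lemma triangleForm_mem_of_abs_latticeDet_eq_one {u v : ℤ × ℤ} (h : |latticeDet u v| = 1) :
    triangleForm u v ∈ factorable := by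
  classical
  set m : ℤ × ℤ := (min 0 (min u.1 v.1), min 0 (min u.2 v.2)) with hm
  have hm1 : m.1 = min 0 (min u.1 v.1) := rfl
  have hm2 : m.2 = min 0 (min u.2 v.2) := rfl
  set V : Finset (ℤ × ℤ) := {-m, u - m, v - m} with hV
  have hVne : V.Nonempty := ⟨-m, by simp [hV]⟩
  set T : Set (ℝ × ℝ) := convexHull ℝ (toR '' (V : Set (ℤ × ℤ))) with hT
  have hunit : IsUnitTriangle T := by
    refine ⟨-m, u - m, v - m, by simp [hT, hV, Set.image_insert_eq], ?_, ?_⟩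
    · rw [← h]; congr 1; simp [latticeDet]
    · simp only [Prod.fst_neg, Prod.snd_neg, Prod.fst_sub, Prod.snd_sub]
      omega
  refine ⟨m.1, m.2, 0, 0, Finsupp.single T 1, fun S hS => ?_, fun z => ?_⟩
  · have := Finsupp.support_single_subset hS
    rw [Finset.mem_singleton.1 this]
    exact hunit
  · rw [Finsupp.sum_single_index (by simp), hT,
      maxF_extremePoints_convexHull ((Finset.finite_toSet V).image _) (hVne.to_set.image _),
      maxF_image_toR hVne]
    have hsup : V.sup' hVne latticeForm =
        latticeForm (-m) ⊔ (latticeForm (u - m) ⊔ latticeForm (v - m)) := by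
      simp [hV, Finset.sup'_insert]
    rw [hsup, latticeForm_neg, latticeForm_sub, latticeForm_sub]
    simp only [triangleForm, Pi.sup_apply, Pi.sub_apply, Pi.neg_apply, Pi.zero_apply]
    have : latticeForm m z = m.1 * z.1 + m.2 * z.2 := rfl
    rw [sup_assoc, ← zero_sub (latticeForm m z), max_sub_sub_right, max_sub_sub_right, ← this]
    push_cast
    ring

lemma segmentForm_neg (u : ℤ × ℤ) : segmentForm (-u) = segmentForm u - latticeForm u := by
  ext z
  simp only [segmentForm, latticeForm_neg, Pi.sup_apply, Pi.zero_apply, Pi.neg_apply, Pi.sub_apply]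
  grind

lemma segmentForm_neg_mem {u : ℤ × ℤ} (hu : segmentForm u ∈ factorable) :
    segmentForm (-u) ∈ factorable := by
  rw [segmentForm_neg]
  exact sub_mem hu (latticeForm_mem u)

lemma segmentForm_nsmul (n : ℕ) (u : ℤ × ℤ) : segmentForm (n • u) = n • segmentForm u := by
  unfold segmentForm
  rw [latticeForm_nsmul]
  ext z
  simp only [Pi.sup_apply, Pi.zero_apply, Pi.smul_apply, nsmul_eq_mul, Pi.mul_apply,
    Pi.natCast_apply]
  rw [mul_max_of_nonneg _ _ (Nat.cast_nonneg n), mul_zero]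

lemma segmentForm_add_mem {u v : ℤ × ℤ} (h : |latticeDet u v| = 1)
    (hu : segmentForm u ∈ factorable) (hv : segmentForm v ∈ factorable) :
    segmentForm (u + v) ∈ factorable := by
  have key : segmentForm (u + v) =
      triangleForm u (u + v) + triangleForm v (u + v) - segmentForm u - segmentForm v := by
    ext z
    simp only [segmentForm, triangleForm, latticeForm_add, Pi.sup_apply, Pi.zero_apply,
      Pi.add_apply, Pi.sub_apply]
    grind
  rw [key]
  refine sub_mem (sub_mem (add_mem ?_ ?_) hu) hv <;>
    apply triangleForm_mem_of_abs_latticeDet_eq_one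
  · rw [← h]; simp only [latticeDet, Prod.fst_add, Prod.snd_add]; ring_nf
  · rw [← h, latticeDet_comm u v, abs_neg]
    simp only [latticeDet, Prod.fst_add, Prod.snd_add]; ring_nf

lemma segmentForm_nsmul_add_nsmul_mem (a b : ℕ) {u v : ℤ × ℤ} (h : |latticeDet u v| = 1)
    (hu : segmentForm u ∈ factorable) (hv : segmentForm v ∈ factorable) :
    segmentForm (a • u + b • v) ∈ factorable := by
  induction hn : a + b using Nat.strong_induction_on generalizing a b u v with
  | _ n ih =>
  rcases Nat.eq_zero_or_pos a with rfl | ha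
  · simpa only [zero_smul, zero_add, segmentForm_nsmul] using nsmul_mem hv b
  rcases Nat.eq_zero_or_pos b with rfl | hb
  · simpa only [zero_smul, add_zero, segmentForm_nsmul] using nsmul_mem hu a
  have huv := segmentForm_add_mem h hu hv
  rcases le_total a b with hab | hab
  · obtain ⟨c, rfl⟩ := Nat.exists_eq_add_of_le hab
    have := ih (a + c) (by omega) a c (u := u + v) (v := v)
      (by rw [← h]; simp only [latticeDet, Prod.fst_add, Prod.snd_add]; ring_nf) huv hv rfl
    convert this using 2
    simp only [smul_add, add_smul]; abel
  · obtain ⟨c, rfl⟩ := Nat.exists_eq_add_of_le hab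
    have := ih (c + b) (by omega) c b (u := u) (v := u + v)
      (by rw [← h]; simp only [latticeDet, Prod.fst_add, Prod.snd_add]; ring_nf) hu huv rfl
    convert this using 2
    simp only [smul_add, add_smul]; abel

lemma segmentForm_mem (u : ℤ × ℤ) : segmentForm u ∈ factorable := by
  have hx : segmentForm (1, 0) ∈ factorable :=
    ⟨0, 0, 1, 0, 0, by simp, by simp [segmentForm, latticeForm]⟩
  have hy : segmentForm (0, 1) ∈ factorable :=
    ⟨0, 0, 0, 1, 0, by simp, by simp [segmentForm, latticeForm]⟩
  obtain ⟨e, he, hxe, hde⟩ : ∃ e : ℤ × ℤ, segmentForm e ∈ factorable ∧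
      u.1.natAbs • e = (u.1, 0) ∧ (e = (1, 0) ∨ e = -(1, 0)) := by
    rcases le_total 0 u.1 with h | h
    · exact ⟨_, hx, by ext <;> simp [abs_of_nonneg h], .inl rfl⟩
    · exact ⟨_, segmentForm_neg_mem hx, by ext <;> simp [abs_of_nonpos h], .inr rfl⟩
  obtain ⟨f, hf, hyf, hdf⟩ : ∃ e : ℤ × ℤ, segmentForm e ∈ factorable ∧
      u.2.natAbs • e = (0, u.2) ∧ (e = (0, 1) ∨ e = -(0, 1)) := by
    rcases le_total 0 u.2 with h | h
    · exact ⟨_, hy, by ext <;> simp [abs_of_nonneg h], .inl rfl⟩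
    · exact ⟨_, segmentForm_neg_mem hy, by ext <;> simp [abs_of_nonpos h], .inr rfl⟩
  have hdet : |latticeDet e f| = 1 := by
    rcases hde with rfl | rfl <;> rcases hdf with rfl | rfl <;> simp [latticeDet]
  have := segmentForm_nsmul_add_nsmul_mem u.1.natAbs u.2.natAbs hdet he hf
  rw [hxe, hyf] at this
  simpa using this

lemma triangleForm_mem_of_latticeDet_eq_zero {u v : ℤ × ℤ} (h : latticeDet u v = 0) :
    triangleForm u v ∈ factorable := by
  by_cases hu : u = 0
  · have : triangleForm u v = segmentForm v := by
      simp [triangleForm, segmentForm, hu, latticeForm_zero]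
    exact this ▸ segmentForm_mem v
  obtain ⟨s, hs⟩ : ∃ s : ℝ, latticeForm v = s • latticeForm u := by
    have h' : (u.1 : ℝ) * v.2 - u.2 * v.1 = 0 := by exact_mod_cast h
    by_cases h1 : u.1 = 0
    · have h2 : (u.2 : ℝ) ≠ 0 := by
        intro h2; exact hu (Prod.ext h1 (by exact_mod_cast h2))
      have h3 : (v.1 : ℝ) = 0 := by simpa [h1, h2] using h'
      refine ⟨v.2 / u.2, ?_⟩
      ext z
      simp only [latticeForm, Pi.smul_apply, smul_eq_mul, h3, h1]
      field_simp
      push_cast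
      ring
    · have h2 : (u.1 : ℝ) ≠ 0 := by exact_mod_cast h1
      refine ⟨v.1 / u.1, ?_⟩
      ext z
      simp only [latticeForm, Pi.smul_apply, smul_eq_mul]
      field_simp
      linear_combination z.2 * h'
  rcases le_total s 0 with h0 | h0
  · have : triangleForm u v = latticeForm u + segmentForm (v - u) := by
      ext z
      have := congrFun hs z
      simp only [Pi.smul_apply, smul_eq_mul] at this
      simp only [triangleForm, segmentForm, latticeForm_sub, Pi.sup_apply, Pi.zero_apply,
        Pi.add_apply, Pi.sub_apply]
      rcases le_total (latticeForm u z) 0 with hz | hz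
      · have : 0 ≤ latticeForm v z := by rw [this]; exact mul_nonneg_of_nonpos_of_nonpos h0 hz
        grind
      · grind
    rw [this]
    exact add_mem (latticeForm_mem _) (segmentForm_mem _)
  rcases le_total s 1 with h1 | h1
  · have : triangleForm u v = segmentForm u := by
      ext z
      have := congrFun hs z
      simp only [Pi.smul_apply, smul_eq_mul] at this
      simp only [triangleForm, segmentForm, Pi.sup_apply, Pi.zero_apply]
      rcases le_total (latticeForm u z) 0 with hz | hz
      · have : latticeForm v z ≤ 0 := by rw [this]; exact mul_nonpos_of_nonneg_of_nonpos h0 hz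
        grind
      · have : latticeForm v z ≤ latticeForm u z := by
          rw [this]; exact mul_le_of_le_one_left hz h1
        grind
    exact this ▸ segmentForm_mem u
  · have : triangleForm u v = segmentForm v := by
      ext z
      have := congrFun hs z
      simp only [Pi.smul_apply, smul_eq_mul] at this
      simp only [triangleForm, segmentForm, Pi.sup_apply, Pi.zero_apply]
      rcases le_total (latticeForm u z) 0 with hz | hz
      · grind
      · have : latticeForm u z ≤ latticeForm v z := by
          rw [this]; exact le_mul_of_one_le_left hz h1
        grind
    exact this ▸ segmentForm_mem v

/-- A lattice triangle of determinant at least `2` contains a lattice point other than its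
vertices. -/
lemma exists_lattice_point {u v : ℤ × ℤ} (h : 2 ≤ latticeDet u v) :
    ∃ (q : ℤ × ℤ) (S T : ℤ), latticeDet u v • q = S • u + T • v ∧ 0 ≤ S ∧ 0 ≤ T ∧ 0 < S + T ∧
      S < latticeDet u v ∧ T < latticeDet u v ∧ S + T ≤ latticeDet u v := by
  set D := latticeDet u v with hD
  have hD0 : 0 < D := by omega
  obtain ⟨w, hw⟩ : ∃ w : ℤ × ℤ, ¬ (D ∣ latticeDet w v ∧ D ∣ latticeDet u w) := by
    by_contra! hcon
    obtain ⟨⟨a, ha⟩, ⟨b, hb⟩⟩ := hcon (1, 0)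
    obtain ⟨⟨c, hc⟩, ⟨d, hd⟩⟩ := hcon (0, 1)
    simp only [latticeDet] at ha hb hc hd hD
    have h1 : D * (D * (a * d - b * c)) = D * 1 := by
      have e1 : v.2 = D * a := by linarith
      have e2 : u.2 = -(D * b) := by linarith
      have e3 : v.1 = -(D * c) := by linarith
      have e4 : u.1 = D * d := by linarith
      rw [e1, e2, e3, e4] at hD
      linear_combination -hD
    have h2 := mul_left_cancel₀ hD0.ne' h1
    have := Int.le_of_dvd one_pos (Dvd.intro _ h2)
    omega
  have hw' : D • w = latticeDet w v • u + latticeDet u w • v := by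
    ext <;> simp [hD, latticeDet] <;> ring
  set s := latticeDet w v
  set t := latticeDet u w
  have hs := Int.emod_add_mul_ediv s D
  have ht := Int.emod_add_mul_ediv t D
  have hs0 := Int.emod_nonneg s hD0.ne'
  have ht0 := Int.emod_nonneg t hD0.ne'
  have hs1 := Int.emod_lt_of_pos s hD0
  have ht1 := Int.emod_lt_of_pos t hD0
  have hpos : 0 < s % D + t % D := by
    by_contra hle
    exact hw ⟨Int.dvd_of_emod_eq_zero (by omega), Int.dvd_of_emod_eq_zero (by omega)⟩
  have hq : D • (w - (s / D) • u - (t / D) • v) = (s % D) • u + (t % D) • v := by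
    have e1 := congrArg Prod.fst hw'
    have e2 := congrArg Prod.snd hw'
    simp only [Prod.smul_fst, Prod.smul_snd, Prod.fst_add, Prod.snd_add, smul_eq_mul] at e1 e2
    ext <;> simp only [Prod.smul_fst, Prod.smul_snd, Prod.fst_add, Prod.snd_add, Prod.fst_sub,
      Prod.snd_sub, smul_eq_mul]
    · linear_combination e1 - u.1 * hs - v.1 * ht
    · linear_combination e2 - u.2 * hs - v.2 * ht
  by_cases hle : s % D + t % D ≤ D
  · exact ⟨_, _, _, hq, hs0, ht0, hpos, hs1, ht1, hle⟩
  · refine ⟨u + v - (w - (s / D) • u - (t / D) • v), D - s % D, D - t % D, ?_, ?_⟩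
    · rw [smul_sub, hq]; module
    · omega

lemma triangle_subdivision_identity {u v q S T D : ℝ} (hq : D * q = S * u + T * v) (hD : 0 < D)
    (hS : 0 ≤ S) (hT : 0 ≤ T) (hST : S + T ≤ D) :
    max (max 0 u) v = max (max 0 u) q + max (max 0 v) q + (q + max (max 0 (u - q)) (v - q)) -
      max 0 q - (q + max 0 (u - q)) - (q + max 0 (v - q)) + q := by
  have hub : q ≤ max (max 0 u) v := by
    by_contra! hlt
    have h0 : 0 < q := lt_of_le_of_lt (by simp) hlt
    have h1 : u < q := lt_of_le_of_lt (by simp) hlt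
    have h2 : v < q := lt_of_le_of_lt (by simp) hlt
    have := mul_nonneg hS (sub_pos.2 h1).le
    have := mul_nonneg hT (sub_pos.2 h2).le
    rcases hS.eq_or_lt with rfl | hS'
    · rcases hT.eq_or_lt with rfl | hT'
      · nlinarith [mul_pos hD h0]
      · nlinarith [mul_pos hT' (sub_pos.2 h2)]
    · nlinarith [mul_pos hS' (sub_pos.2 h1)]
  have hlb : min (min 0 u) v ≤ q := by
    by_contra! hlt
    have h0 : q < 0 := lt_of_lt_of_le hlt (by simp)
    have h1 : q < u := lt_of_lt_of_le hlt (by simp)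
    have h2 : q < v := lt_of_lt_of_le hlt (by simp)
    have := mul_nonneg hS (sub_pos.2 h1).le
    have := mul_nonneg hT (sub_pos.2 h2).le
    rcases hS.eq_or_lt with rfl | hS'
    · rcases hT.eq_or_lt with rfl | hT'
      · nlinarith [mul_pos hD (neg_pos.2 h0)]
      · nlinarith [mul_pos hT' (sub_pos.2 h2)]
    · nlinarith [mul_pos hS' (sub_pos.2 h1)]
  clear hq hS hT hST hD
  grind

lemma triangleForm_mem (u v : ℤ × ℤ) : triangleForm u v ∈ factorable := by
  induction hn : (latticeDet u v).natAbs using Nat.strong_induction_on generalizing u v with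
  | _ n ih =>
  wlog hpos : 0 ≤ latticeDet u v generalizing u v
  · have hcomm := latticeDet_comm u v
    rw [triangleForm_comm]
    exact this v u (by omega) (by omega)
  rcases hpos.eq_or_lt with h0 | h0
  · exact triangleForm_mem_of_latticeDet_eq_zero h0.symm
  by_cases h1 : latticeDet u v = 1
  · exact triangleForm_mem_of_abs_latticeDet_eq_one (by simp [h1])
  obtain ⟨q, S, T, hq, hS, hT, hST, hSD, hTD, hle⟩ := exists_lattice_point (u := u) (v := v)
    (by omega)
  set D := latticeDet u v with hD
  have e1 := congrArg Prod.fst hq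
  have e2 := congrArg Prod.snd hq
  simp only [Prod.smul_fst, Prod.smul_snd, Prod.fst_add, Prod.snd_add, smul_eq_mul] at e1 e2
  have d1 : latticeDet u q = T := by
    refine mul_left_cancel₀ h0.ne' ?_
    have : D * latticeDet u q = T * (u.1 * v.2 - u.2 * v.1) := by
      simp only [latticeDet]; linear_combination u.1 * e2 - u.2 * e1
    rw [this, hD, latticeDet]; ring
  have d2 : latticeDet v q = -S := by
    refine mul_left_cancel₀ h0.ne' ?_
    have : D * latticeDet v q = -S * (u.1 * v.2 - u.2 * v.1) := by
      simp only [latticeDet]; linear_combination v.1 * e2 - v.2 * e1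
    rw [this, hD, latticeDet]; ring
  have d3 : latticeDet (u - q) (v - q) = D - S - T := by
    have : latticeDet (u - q) (v - q) = D - latticeDet u q + latticeDet v q := by
      simp only [hD, latticeDet, Prod.fst_sub, Prod.snd_sub]; ring
    rw [this, d1, d2]; ring
  have t1 := ih _ (by omega) u q rfl
  have t2 := ih _ (by omega) v q rfl
  have t3 := ih _ (by omega) (u - q) (v - q) rfl
  have key : triangleForm u v = triangleForm u q + triangleForm v q +
      (latticeForm q + triangleForm (u - q) (v - q)) - segmentForm q -
      (latticeForm q + segmentForm (u - q)) - (latticeForm q + segmentForm (v - q)) +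
      latticeForm q := by
    ext z
    simp only [triangleForm, segmentForm, latticeForm_sub, Pi.sup_apply, Pi.zero_apply,
      Pi.add_apply, Pi.sub_apply]
    have r1 : (D : ℝ) * q.1 = S * u.1 + T * v.1 := by exact_mod_cast e1
    have r2 : (D : ℝ) * q.2 = S * u.2 + T * v.2 := by exact_mod_cast e2
    refine triangle_subdivision_identity (S := S) (T := T) (D := D) ?_ (by exact_mod_cast h0)
      (by exact_mod_cast hS) (by exact_mod_cast hT) (by exact_mod_cast hle)
    simp only [latticeForm]
    linear_combination z.1 * r1 + z.2 * r2
  have hl := latticeForm_mem q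
  rw [key]
  exact add_mem (sub_mem (sub_mem (sub_mem (add_mem (add_mem t1 t2) (add_mem hl t3))
    (segmentForm_mem _)) (add_mem hl (segmentForm_mem _))) (add_mem hl (segmentForm_mem _))) hl

lemma sup_three_mem (p q r : ℤ × ℤ) :
    latticeForm p ⊔ (latticeForm q ⊔ latticeForm r) ∈ factorable := by
  have : latticeForm p ⊔ (latticeForm q ⊔ latticeForm r) =
      latticeForm p + triangleForm (q - p) (r - p) := by
    ext z
    simp only [triangleForm, latticeForm_sub, Pi.sup_apply, Pi.zero_apply, Pi.add_apply,
      Pi.sub_apply]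
    grind
  rw [this]
  exact add_mem (latticeForm_mem p) (triangleForm_mem _ _)

lemma toR_injective : Function.Injective toR := fun p q h => by
  simpa [toR, Prod.ext_iff] using h

/-- Among at least four lattice points there is a Radon-type relation whose positive part is
supported on at most two points. -/
lemma exists_relation {P : Finset (ℤ × ℤ)} (hP : 4 ≤ P.card) :
    ∃ (i j : ℤ × ℤ) (J : Finset (ℤ × ℤ)) (a b : ℝ) (w : ℤ × ℤ → ℝ),
      i ∈ P ∧ j ∈ P ∧ J ⊆ P ∧ i ∉ J ∧ j ∉ J ∧ J.Nonempty ∧ 0 < a ∧ 0 < b ∧ (∀ p ∈ J, 0 < w p) ∧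
      ∑ p ∈ J, w p = a + b ∧
      ∑ p ∈ J, w p • latticeForm p = a • latticeForm i + b • latticeForm j := by
  classical
  obtain ⟨Q, hQP, hQ⟩ := Finset.exists_subset_card_eq hP
  obtain ⟨f, hf, hf0, x, hx, hfx⟩ :=
    Module.exists_nontrivial_relation_sum_zero_of_finrank_succ_lt_card (R := ℝ)
      (t := Q.map ⟨toR, toR_injective⟩) (by simp [hQ])
  simp only [Finset.sum_map, Function.Embedding.coeFn_mk] at hf hf0
  obtain ⟨x, hxQ, rfl⟩ := Finset.mem_map.1 hx
  obtain ⟨w, hw, hw0, hwx, hcard⟩ : ∃ w : ℤ × ℤ → ℝ, ∑ p ∈ Q, w p • latticeForm p = 0 ∧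
      ∑ p ∈ Q, w p = 0 ∧ w x ≠ 0 ∧ (Q.filter (0 < w ·)).card ≤ 2 := by
    have hlin : ∑ p ∈ Q, f (toR p) • latticeForm p = 0 := by
      ext z
      have h1 := congrArg Prod.fst hf
      have h2 := congrArg Prod.snd hf
      simp only [Prod.fst_sum, Prod.snd_sum, toR, Prod.smul_fst, Prod.smul_snd, smul_eq_mul,
        Prod.fst_zero, Prod.snd_zero] at h1 h2
      simp only [Finset.sum_apply, Pi.smul_apply, smul_eq_mul, latticeForm, Pi.zero_apply,
        mul_add, Finset.sum_add_distrib, ← mul_assoc, ← Finset.sum_mul, toR, h1, h2]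
      simp
    by_cases hc : (Q.filter (fun p => 0 < f (toR p))).card ≤ 2
    · exact ⟨fun p => f (toR p), hlin, hf0, hfx, hc⟩
    · refine ⟨fun p => -f (toR p), by simp [hlin], by simp [hf0], by simpa using hfx, ?_⟩
      beta_reduce
      have hd : Disjoint (Q.filter (fun p => 0 < f (toR p)))
          (Q.filter (fun p => 0 < -f (toR p))) := by
        rw [Finset.disjoint_filter]; intro p _ h1 h2; linarith
      have := Finset.card_le_card (Finset.union_subset
        (Finset.filter_subset (fun p => 0 < f (toR p)) Q)
        (Finset.filter_subset (fun p => 0 < -f (toR p)) Q))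
      rw [Finset.card_union_of_disjoint hd] at this
      omega
  set I := Q.filter (0 < w ·) with hI
  set J := Q.filter (w · < 0) with hJ
  have hsplit : ∀ {M : Type} [AddCommGroup M] (g : ℤ × ℤ → M), (∀ p, w p = 0 → g p = 0) →
      ∑ p ∈ Q, g p = ∑ p ∈ I, g p + ∑ p ∈ J, g p := by
    intro M _ g hg
    rw [hI, hJ, Finset.sum_filter, Finset.sum_filter, ← Finset.sum_add_distrib]
    refine Finset.sum_congr rfl fun p _ => ?_
    rcases lt_trichotomy (w p) 0 with h | h | h
    · simp [h, h.not_gt]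
    · simp [h, hg p h]
    · simp [h, h.not_gt]
  have s0 := hsplit w (fun _ h => h)
  have s1 := hsplit (fun p => w p • latticeForm p) (fun p h => by simp [h])
  rw [hw0] at s0
  rw [hw] at s1
  have hIne : I.Nonempty := by
    by_contra hne
    rw [Finset.not_nonempty_iff_eq_empty] at hne
    rw [hne, Finset.sum_empty, zero_add] at s0
    have hxJ : x ∈ J := by
      have : x ∉ I := by simp [hne]
      simp only [hI, hJ, Finset.mem_filter, hxQ, true_and, not_lt] at this ⊢
      exact lt_of_le_of_ne this hwx
    have : ∑ p ∈ J, w p < 0 :=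
      Finset.sum_neg (fun p hp => (Finset.mem_filter.1 hp).2) ⟨x, hxJ⟩
    linarith
  have hIpos : 0 < ∑ p ∈ I, w p :=
    Finset.sum_pos (fun p hp => (Finset.mem_filter.1 hp).2) hIne
  have hJne : J.Nonempty := by
    by_contra hne
    rw [Finset.not_nonempty_iff_eq_empty] at hne
    rw [hne, Finset.sum_empty] at s0
    linarith
  have hJP : J ⊆ P := (Finset.filter_subset _ _).trans hQP
  have hIJ : ∀ p ∈ I, p ∈ P ∧ p ∉ J ∧ 0 < w p := fun p hp => by
    have := Finset.mem_filter.1 hp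
    exact ⟨hQP this.1, fun h => (this.2.trans (Finset.mem_filter.1 h).2).false, this.2⟩
  have hJw : ∀ p ∈ J, 0 < -w p := fun p hp => neg_pos.2 (Finset.mem_filter.1 hp).2
  have hcard' : I.card = 1 ∨ I.card = 2 := by
    have := hIne.card_pos
    omega
  rcases hcard' with h | h
  · obtain ⟨i, hi⟩ := Finset.card_eq_one.1 h
    obtain ⟨h1, h2, h3⟩ := hIJ i (by simp [hi])
    rw [hi, Finset.sum_singleton] at s0 s1
    refine ⟨i, i, J, w i / 2, w i / 2, fun p => -w p, h1, h1, hJP, h2, h2, hJne, half_pos h3,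
      half_pos h3, hJw, ?_, ?_⟩
    · rw [Finset.sum_neg_distrib]; linarith
    · simp only [neg_smul, Finset.sum_neg_distrib]
      rw [← add_smul, add_halves]
      exact (eq_neg_of_add_eq_zero_left s1.symm).symm
  · obtain ⟨i, j, hij, hi⟩ := Finset.card_eq_two.1 h
    obtain ⟨h1, h2, h3⟩ := hIJ i (by simp [hi])
    obtain ⟨h1', h2', h3'⟩ := hIJ j (by simp [hi])
    rw [hi, Finset.sum_pair hij] at s0 s1
    refine ⟨i, j, J, w i, w j, fun p => -w p, h1, h1', hJP, h2, h2', hJne, h3, h3', hJw, ?_, ?_⟩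
    · rw [Finset.sum_neg_distrib]; linarith
    · simp only [neg_smul, Finset.sum_neg_distrib]
      exact (eq_neg_of_add_eq_zero_left s1.symm).symm

lemma sup'_latticeForm_mem (P : Finset (ℤ × ℤ)) (hP : P.Nonempty) :
    P.sup' hP latticeForm ∈ factorable := by
  classical
  induction P using Finset.strongInduction with
  | _ P ih =>
  by_cases hcard : 4 ≤ P.card
  · obtain ⟨i, j, J, a, b, w, hi, hj, hJP, hiJ, hjJ, hJne, ha, hb, hw, hsum, hrel⟩ :=
      exists_relation hcard
    set R := (P.erase i).erase j with hR
    have hJR : J ⊆ R := fun p hp => Finset.mem_erase.2 ⟨fun h => hjJ (h ▸ hp),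
      Finset.mem_erase.2 ⟨fun h => hiJ (h ▸ hp), hJP hp⟩⟩
    have hRne : R.Nonempty := hJne.mono hJR
    have hRi : R ⊂ P := (Finset.erase_subset _ _).trans_ssubset (Finset.erase_ssubset hi)
    have hmin : ∀ z, min (latticeForm i z) (latticeForm j z) ≤ R.sup' hRne latticeForm z := by
      intro z
      have hz := congrFun hrel z
      simp only [Finset.sum_apply, Pi.smul_apply, smul_eq_mul, Pi.add_apply] at hz
      have hle : ∑ p ∈ J, w p * latticeForm p z ≤
          ∑ p ∈ J, w p * R.sup' hRne latticeForm z := by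
        refine Finset.sum_le_sum fun p hp => mul_le_mul_of_nonneg_left ?_ (hw p hp).le
        exact Finset.le_sup' latticeForm (hJR hp) z
      rw [← Finset.sum_mul, hsum, hz] at hle
      by_contra! hlt
      obtain ⟨h1, h2⟩ := lt_min_iff.1 hlt
      nlinarith [mul_pos ha (sub_pos.2 h1), mul_pos hb (sub_pos.2 h2)]
    by_cases hij : i = j
    · subst hij
      have hins : P = insert i R := by
        rw [hR]; ext p; by_cases h : p = i <;> simp [h, hi]
      have : P.sup' hP latticeForm = R.sup' hRne latticeForm := by
        simp only [hins, Finset.sup'_insert hRne]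
        exact sup_eq_right.2 fun z => by simpa using hmin z
      rw [this]
      exact ih R hRi hRne
    · have hins : P = insert i (insert j R) := by
        rw [hR]; ext p; by_cases h : p = i <;> by_cases h' : p = j <;> simp [h, h', hi, hj]
      have hiR : insert i R ⊂ P := by
        rw [hins]
        refine Finset.insert_subset_insert _ (Finset.subset_insert _ _) |>.ssubset_of_ne ?_
        intro h
        have : j ∈ insert i R := h ▸ (by simp)
        simp [hR, Ne.symm hij] at this
      have hjR : insert j R ⊂ P := by
        have : insert j R ⊂ insert i (insert j R) := Finset.ssubset_insert (by simp [hR, hij])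
        rwa [← hins] at this
      have key : P.sup' hP latticeForm = (insert i R).sup' (Finset.insert_nonempty _ _) latticeForm
          + (insert j R).sup' (Finset.insert_nonempty _ _) latticeForm
          - R.sup' hRne latticeForm := by
        have : P.sup' hP latticeForm =
            latticeForm i ⊔ (latticeForm j ⊔ R.sup' hRne latticeForm) := by
          simp only [hins, Finset.sup'_insert hRne, Finset.sup'_insert (Finset.insert_nonempty j R)]
        rw [this, Finset.sup'_insert hRne, Finset.sup'_insert hRne]
        ext z
        have := hmin z
        simp only [Pi.sup_apply, Pi.add_apply, Pi.sub_apply]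
        generalize R.sup' hRne latticeForm z = A at *
        grind
      rw [key]
      exact sub_mem (add_mem (ih _ hiR _) (ih _ hjR _)) (ih R hRi hRne)
  · have hpos := hP.card_pos
    have : P.card = 1 ∨ P.card = 2 ∨ P.card = 3 := by omega
    rcases this with h | h | h
    · obtain ⟨p, rfl⟩ := Finset.card_eq_one.1 h
      simpa using latticeForm_mem p
    · obtain ⟨p, q, -, rfl⟩ := Finset.card_eq_two.1 h
      simpa [Finset.sup'_insert] using sup_three_mem p q q
    · obtain ⟨p, q, r, -, -, -, rfl⟩ := Finset.card_eq_three.1 h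
      simpa [Finset.sup'_insert] using sup_three_mem p q r

/-- Every difference of two max-plus functions with integer
coefficients factors through linear terms, `max(0,x)`, `max(0,y)`, and max-plus
functions of the vertices of finitely many unit triangles, with (possibly negative)
integer coefficients. -/
theorem maxPlus_difference_factorization (P' P'' : Finset (ℤ × ℤ)) (hP' : P'.Nonempty) (hP'' : P''.Nonempty) :
    ∃ (a₀ b₀ kx ky : ℤ) (S : Finset (Set (ℝ × ℝ))) (k : Set (ℝ × ℝ) → ℤ),
      (∀ T ∈ S, IsUnitTriangle T) ∧
      ∀ x y : ℝ,
        maxF (toR '' (P' : Set (ℤ × ℤ))) x y - maxF (toR '' (P'' : Set (ℤ × ℤ))) x y =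
          (a₀ : ℝ) * x + (b₀ : ℝ) * y + (kx : ℝ) * max 0 x + (ky : ℝ) * max 0 y +
            ∑ T ∈ S, (k T : ℝ) * maxF (Set.extremePoints ℝ T) x y := by
  obtain ⟨a, b, kx, ky, k, hk, h⟩ :=
    sub_mem (sup'_latticeForm_mem P' hP') (sup'_latticeForm_mem P'' hP'')
  refine ⟨a, b, kx, ky, k.support, k, hk, fun x y => ?_⟩
  rw [maxF_image_toR hP' (x, y), maxF_image_toR hP'' (x, y)]
  exact h (x, y)
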